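/- arXiv:math/0307243 — 7 statements merged into one kernel-verified Lean document; each statement's English description precedes it below -/
import Mathlib

section
/- Let G be a group and f : G → ℂ a function with f(e) = 0 and conj(f(g)) = f(g⁻¹) for all g. Then the following are equivalent: (1) for every real t > 0 the function g ↦ exp(t·f(g)) is positive definite on G (for all g₁,…,gₙ ∈ G and λ₁,…,λₙ ∈ ℂ, ∑_{i,j} conj(λᵢ)λⱼ exp(t f(gᵢ⁻¹gⱼ)) is a nonnegative real); (2) f is conditionally positive semidefinite: for all g₁,…,gₙ ∈ G and λ₁,…,λₙ ∈ ℂ, the sum ∑_{i,j} conj(λᵢ)λⱼ (f(gᵢ⁻¹gⱼ) − f(gᵢ⁻¹) − f(gⱼ)) is a nonnegative real number. -/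
open Finset

open scoped ComplexOrder in
lemma psd_sum {n : ℕ} {K : Matrix (Fin n) (Fin n) ℂ} (hK : K.PosSemidef) (l : Fin n → ℂ) :
    0 ≤ ∑ i : Fin n, ∑ j : Fin n, (starRingEnd ℂ) (l i) * l j * K i j := by
  have h := hK.dotProduct_mulVec_nonneg l
  convert h using 1
  simp only [dotProduct, Matrix.mulVec, Finset.mul_sum, Pi.star_apply]
  refine Finset.sum_congr rfl fun i _ => Finset.sum_congr rfl fun j _ => ?_
  simp only [starRingEnd_apply]
  ring

open scoped ComplexOrder in
lemma psd_pow {n : ℕ} {K : Matrix (Fin n) (Fin n) ℂ} (hK : K.PosSemidef) (k : ℕ) :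
    (Matrix.of fun i j => K i j ^ k : Matrix (Fin n) (Fin n) ℂ).PosSemidef := by
  induction k with
  | zero =>
    have h := Matrix.posSemidef_vecMulVec_self_star (fun _ : Fin n => (1 : ℂ))
    convert h using 1
    ext i j
    simp [Matrix.vecMulVec_apply]
  | succ k ih =>
    have h := ih.hadamard hK
    have e : (Matrix.of fun i j => K i j ^ (k + 1) : Matrix (Fin n) (Fin n) ℂ) =
        (Matrix.of fun i j => K i j ^ k : Matrix (Fin n) (Fin n) ℂ).hadamard K := by
      ext i j
      simp [Matrix.hadamard_apply, pow_succ]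
    rw [e]
    exact h

open scoped ComplexOrder in
lemma psd_exp {n : ℕ} {K : Matrix (Fin n) (Fin n) ℂ} (hK : K.PosSemidef) (t : ℝ) (ht : 0 < t)
    (l : Fin n → ℂ) :
    0 ≤ ∑ i : Fin n, ∑ j : Fin n, (starRingEnd ℂ) (l i) * l j * Complex.exp ((t : ℂ) * K i j) := by
  have hs : HasSum (fun k : ℕ => ∑ i : Fin n, ∑ j : Fin n,
      (starRingEnd ℂ) (l i) * l j * (((t : ℂ) * K i j) ^ k / (k.factorial : ℂ)))
      (∑ i : Fin n, ∑ j : Fin n,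
        (starRingEnd ℂ) (l i) * l j * Complex.exp ((t : ℂ) * K i j)) := by
    refine hasSum_sum fun i _ => hasSum_sum fun j _ => HasSum.mul_left _ ?_
    rw [Complex.exp_eq_exp_ℂ]
    exact NormedSpace.expSeries_div_hasSum_exp _
  refine hs.nonneg fun k => ?_
  have h := psd_sum (psd_pow hK k) l
  have h2 : (0 : ℂ) ≤ ((t ^ k / k.factorial : ℝ) : ℂ) := by
    rw [Complex.zero_le_real]; positivity
  have h3 := mul_nonneg h2 h
  convert h3 using 1
  simp only [Finset.mul_sum, Matrix.of_apply]
  refine Finset.sum_congr rfl fun i _ => Finset.sum_congr rfl fun j _ => ?_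
  push_cast
  ring

open scoped ComplexOrder in
lemma nonneg_iff_aux (z : ℂ) : (z.im = 0 ∧ 0 ≤ z.re) ↔ 0 ≤ z := by
  rw [Complex.nonneg_iff]
  constructor
  · rintro ⟨a, b⟩; exact ⟨b, a.symm⟩
  · rintro ⟨a, b⟩; exact ⟨b.symm, a⟩

open scoped ComplexOrder in
lemma deriv_nonneg_aux {n : ℕ} (K : Fin n → Fin n → ℂ) (l : Fin n → ℂ) (hl : ∑ i, l i = 0)
    (h : ∀ t : ℝ, 0 < t →
      0 ≤ ∑ i, ∑ j, (starRingEnd ℂ) (l i) * l j * Complex.exp ((t : ℂ) * K i j)) :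
    0 ≤ ∑ i, ∑ j, (starRingEnd ℂ) (l i) * l j * K i j := by
  have hd : HasDerivAt (fun t : ℝ => ∑ i, ∑ j,
      (starRingEnd ℂ) (l i) * l j * Complex.exp ((t : ℂ) * K i j))
      (∑ i, ∑ j, (starRingEnd ℂ) (l i) * l j * K i j) 0 := by
    refine HasDerivAt.fun_sum fun i _ => HasDerivAt.fun_sum fun j _ => HasDerivAt.const_mul _ ?_
    have h1 : HasDerivAt (fun t : ℝ => (t : ℂ) * K i j) (1 * K i j) 0 :=
      (Complex.ofRealCLM.hasDerivAt (x := (0 : ℝ))).mul_const _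
    simpa using h1.cexp
  have ht := (hasDerivAt_iff_tendsto_slope.1 hd).mono_left
    (nhdsWithin_mono (0 : ℝ) (s := Set.Ioi 0) fun x hx => ne_of_gt hx)
  refine ge_of_tendsto ht ?_
  filter_upwards [self_mem_nhdsWithin] with t htpos
  have h0 : ∑ i, ∑ j, (starRingEnd ℂ) (l i) * l j * Complex.exp (((0 : ℝ) : ℂ) * K i j) = 0 := by
    simp [← Finset.mul_sum, hl]
  rw [slope_def_module, h0, sub_zero, sub_zero, Complex.real_smul]
  refine mul_nonneg ?_ (h t htpos)
  rw [Complex.zero_le_real]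
  exact inv_nonneg.2 (le_of_lt htpos)


open Finset

/-- Schoenberg's theorem for groups: for a hermitian function `f` with
`f(e) = 0`, the functions `exp(t·f)` are positive definite for all `t > 0`
if and only if `f` is conditionally positive semidefinite. -/
theorem schoenberg_infinitely_divisible
    {G : Type*} [Group G] (f : G → ℂ)
    (hfe : f 1 = 0)
    (hherm : ∀ g, (starRingEnd ℂ) (f g) = f g⁻¹) :
    (∀ t : ℝ, 0 < t → ∀ (n : ℕ) (g : Fin n → G) (l : Fin n → ℂ),
      (∑ i : Fin n, ∑ j : Fin n,
        (starRingEnd ℂ) (l i) * l j * Complex.exp ((t : ℂ) * f ((g i)⁻¹ * g j))).im = 0 ∧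
      0 ≤ (∑ i : Fin n, ∑ j : Fin n,
        (starRingEnd ℂ) (l i) * l j * Complex.exp ((t : ℂ) * f ((g i)⁻¹ * g j))).re)
    ↔
    (∀ (n : ℕ) (g : Fin n → G) (l : Fin n → ℂ),
      (∑ i : Fin n, ∑ j : Fin n,
        (starRingEnd ℂ) (l i) * l j * (f ((g i)⁻¹ * g j) - f (g i)⁻¹ - f (g j))).im = 0 ∧
      0 ≤ (∑ i : Fin n, ∑ j : Fin n,
        (starRingEnd ℂ) (l i) * l j * (f ((g i)⁻¹ * g j) - f (g i)⁻¹ - f (g j))).re) := by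
  simp only [nonneg_iff_aux]
  constructor
  · intro h n g l
    have key := deriv_nonneg_aux
      (fun i j => f (((Fin.cons 1 g : Fin (n + 1) → G) i)⁻¹ * (Fin.cons 1 g : Fin (n + 1) → G) j))
      (Fin.cons (-∑ i, l i) l : Fin (n + 1) → ℂ)
      (by simp [Fin.sum_univ_succ])
      (fun t ht => h t ht (n + 1) _ _)
    convert key using 1
    simp only [Fin.sum_univ_succ, Fin.cons_zero, Fin.cons_succ, inv_one, one_mul, mul_one, hfe,
      mul_zero, zero_add, map_neg, map_sum]
    have e1 : ∑ x, -(∑ i, (starRingEnd ℂ) (l i)) * l x * f (g x) =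
        -∑ i, ∑ j, (starRingEnd ℂ) (l i) * l j * f (g j) := by
      rw [Finset.sum_comm]
      simp only [neg_mul, Finset.sum_neg_distrib, Finset.sum_mul]
    have e2 : ∀ i, (starRingEnd ℂ) (l i) * (-∑ j, l j) * f (g i)⁻¹ =
        -∑ j, (starRingEnd ℂ) (l i) * l j * f (g i)⁻¹ := by
      intro i
      simp only [← Finset.sum_mul, ← Finset.mul_sum]
      ring
    rw [e1]
    simp only [e2, mul_sub, Finset.sum_sub_distrib, Finset.sum_add_distrib, Finset.sum_neg_distrib]
    ring
  · intro h t ht n g l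
    open scoped ComplexOrder in
    have hK : (Matrix.of fun i j => f ((g i)⁻¹ * g j) - f (g i)⁻¹ - f (g j) :
        Matrix (Fin n) (Fin n) ℂ).PosSemidef := by
      refine Matrix.PosSemidef.of_dotProduct_mulVec_nonneg ?_ fun x => ?_
      · ext i j
        simp only [Matrix.conjTranspose_apply, Matrix.of_apply, ← starRingEnd_apply, map_sub,
          hherm, mul_inv_rev, inv_inv]
        ring
      · convert h n g x using 1
        simp only [dotProduct, Matrix.mulVec, Finset.mul_sum, Pi.star_apply, Matrix.of_apply]
        refine Finset.sum_congr rfl fun i _ => Finset.sum_congr rfl fun j _ => ?_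
        simp only [starRingEnd_apply]
        ring
    convert psd_exp hK t ht (fun i => l i * Complex.exp (t * f (g i))) using 1
    refine Finset.sum_congr rfl fun i _ => Finset.sum_congr rfl fun j _ => ?_
    have e : Complex.exp ((t : ℂ) * f ((g i)⁻¹ * g j)) =
        Complex.exp (t * f (g i)⁻¹) * Complex.exp (t * f (g j)) *
        Complex.exp (t * (f ((g i)⁻¹ * g j) - f (g i)⁻¹ - f (g j))) := by
      rw [← Complex.exp_add, ← Complex.exp_add]
      congr 1
      ring
    rw [e]
    simp only [map_mul, ← Complex.exp_conj, Complex.conj_ofReal, hherm, Matrix.of_apply]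
    ring
end

section
/- Let a ∈ ℝ and let f : ℝ → ℂ be a continuous function with f(0) = 0, conj(f(x)) = f(−x) for all x, and f(y − x) − f(−x) − f(y) = a·x·y for all x, y ∈ ℝ. Then there exists b ∈ ℝ such that f(x) = −(a/2)·x² + i·b·x for all x. (The Gaussian is the only continuous hermitian solution with cocycle kernel a·x·y.) -/
/-- The Gaussian is the only continuous hermitian solution with algebraic
cocycle kernel `a·x·y`: if `f : ℝ → ℂ` is continuous, `f(0) = 0`,
`conj(f(x)) = f(−x)`, and `f(y−x) − f(−x) − f(y) = a·x·y` for all `x, y`, then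
`f(x) = −(a/2)x² + ibx` for some real `b`. -/
theorem gaussian_unique_algebraic_cocycle
    (a : ℝ) (f : ℝ → ℂ)
    (hcont : Continuous f)
    (hf0 : f 0 = 0)
    (hherm : ∀ x : ℝ, (starRingEnd ℂ) (f x) = f (-x))
    (hker : ∀ x y : ℝ, f (y - x) - f (-x) - f y = (a : ℂ) * (x : ℂ) * (y : ℂ)) :
    ∃ b : ℝ, ∀ x : ℝ,
      f x = -((a : ℂ) / 2) * (x : ℂ) ^ 2 + Complex.I * (b : ℂ) * (x : ℂ) := by
  have hadd : ∀ x y : ℝ, f (x + y) + ((a : ℂ) / 2) * ((x + y : ℝ) : ℂ) ^ 2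
      = (f x + ((a : ℂ) / 2) * (x : ℂ) ^ 2) + (f y + ((a : ℂ) / 2) * (y : ℂ) ^ 2) := by
    intro x y
    have h := hker (-x) y
    rw [neg_neg, sub_neg_eq_add, add_comm y x] at h
    push_cast at h ⊢
    linear_combination h
  let g : ℝ →+ ℂ :=
    { toFun := fun x => f x + ((a : ℂ) / 2) * (x : ℂ) ^ 2
      map_zero' := by simp [hf0]
      map_add' := hadd }
  have hg : ∀ x, g x = f x + ((a : ℂ) / 2) * (x : ℂ) ^ 2 := fun _ => rfl
  have hgc : Continuous g := by
    change Continuous fun x : ℝ => f x + ((a : ℂ) / 2) * (x : ℂ) ^ 2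
    fun_prop
  have hlin : ∀ x : ℝ, g x = (x : ℂ) * g 1 := by
    intro x
    have h := (g.toRealLinearMap hgc).map_smul x 1
    simpa using h
  have hre : (g 1).re = 0 := by
    have h1 : (starRingEnd ℂ) (g 1) = g (-1) := by
      rw [hg, hg, ← hherm]
      simp [Complex.conj_ofNat]
    rw [map_neg] at h1
    have h2 := congrArg Complex.re h1
    simp only [Complex.conj_re, Complex.neg_re] at h2
    linarith
  have him : g 1 = Complex.I * ((g 1).im : ℂ) := by
    apply Complex.ext <;> simp [hre]
  refine ⟨(g 1).im, fun x => ?_⟩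
  have h := hlin x
  rw [hg x] at h
  linear_combination h + (x : ℂ) * him
end

section
/- Let λ₀ ≥ 0, c ≥ 0, a, b ∈ ℝ, and let P be a finite (nonnegative) measure on ℝ. Define f : ℝ → ℂ by the de Finetti formula f(t) = λ₀·( i·b·t − (a²/2)·t² + c·∫ (exp(i·p·t) − 1) dP(p) ). Then f(0) = 0 and f is conditionally positive semidefinite on the additive group ℝ: for every t₁,…,tₙ ∈ ℝ and λ₁,…,λₙ ∈ ℂ, the sum ∑_{j,k} conj(λⱼ)λₖ (f(tₖ − tⱼ) − f(−tⱼ) − f(tₖ)) is a nonnegative real number; indeed it equals λ₀·( a²·|∑_j λⱼ tⱼ|² + c·∫ |∑_j λⱼ (exp(i·p·tⱼ) − 1)|² dP(p) ). -/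
open Finset MeasureTheory

lemma dF_sq (n : ℕ) (l u : Fin n → ℂ) :
    ∑ j : Fin n, ∑ k : Fin n, (starRingEnd ℂ) (l j) * l k * ((starRingEnd ℂ) (u j) * u k) =
      ((‖∑ j : Fin n, l j * u j‖ ^ 2 : ℝ) : ℂ) := by
  have h := Complex.conj_mul' (∑ j : Fin n, l j * u j)
  push_cast
  rw [← h, map_sum, Finset.sum_mul_sum]
  refine Finset.sum_congr rfl fun j _ => Finset.sum_congr rfl fun k _ => ?_
  rw [map_mul]
  ring

lemma dF_int (P : Measure ℝ) [IsFiniteMeasure P] (t : ℝ) :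
    Integrable (fun p : ℝ => Complex.exp (Complex.I * (p : ℂ) * (t : ℂ)) - 1) P := by
  refine Integrable.of_bound (C := 2) (by fun_prop) (Filter.Eventually.of_forall fun p => ?_)
  have h : ‖Complex.exp (Complex.I * (p : ℂ) * (t : ℂ))‖ = 1 := by
    rw [mul_assoc, ← Complex.ofReal_mul, Complex.norm_exp_I_mul_ofReal]
  calc _ ≤ ‖Complex.exp (Complex.I * (p : ℂ) * (t : ℂ))‖ + ‖(1 : ℂ)‖ := norm_sub_le _ _
    _ = 2 := by rw [h, norm_one]; norm_num

lemma dF_pt (p s t : ℝ) :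
    (Complex.exp (Complex.I * (p : ℂ) * ((t - s : ℝ) : ℂ)) - 1)
      - (Complex.exp (Complex.I * (p : ℂ) * ((-s : ℝ) : ℂ)) - 1)
      - (Complex.exp (Complex.I * (p : ℂ) * (t : ℂ)) - 1) =
    (starRingEnd ℂ) (Complex.exp (Complex.I * (p : ℂ) * (s : ℂ)) - 1) *
      (Complex.exp (Complex.I * (p : ℂ) * (t : ℂ)) - 1) := by
  have h1 : Complex.I * (p : ℂ) * ((t - s : ℝ) : ℂ) =
      Complex.I * (p : ℂ) * ((-s : ℝ) : ℂ) + Complex.I * (p : ℂ) * (t : ℂ) := by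
    push_cast; ring
  have h2 : (starRingEnd ℂ) (Complex.exp (Complex.I * (p : ℂ) * (s : ℂ))) =
      Complex.exp (Complex.I * (p : ℂ) * ((-s : ℝ) : ℂ)) := by
    rw [← Complex.exp_conj]
    congr 1
    simp
  rw [h1, Complex.exp_add, map_sub, h2, map_one]
  ring

/-- De Finetti's formula: for `λ₀, c ≥ 0`, reals `a, b` and a finite measure
`P` on `ℝ`, the exponent
`f(t) = λ₀(ibt − (a²/2)t² + c∫(e^{ipt} − 1) dP(p))`
satisfies `f(0) = 0` and is conditionally positive semidefinite; indeed the
kernel sum equals `λ₀(a²|∑ⱼλⱼtⱼ|² + c∫|∑ⱼλⱼ(e^{iptⱼ} − 1)|² dP(p))`. -/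
theorem deFinetti_conditionally_positive
    (lam : ℝ) (hlam : 0 ≤ lam) (c : ℝ) (hc : 0 ≤ c) (a b : ℝ)
    (P : Measure ℝ) [IsFiniteMeasure P] (f : ℝ → ℂ)
    (hf : ∀ t : ℝ, f t = (lam : ℂ) *
      (Complex.I * (b : ℂ) * (t : ℂ) - ((a : ℂ) ^ 2 / 2) * (t : ℂ) ^ 2 +
        (c : ℂ) * ∫ p : ℝ, (Complex.exp (Complex.I * (p : ℂ) * (t : ℂ)) - 1) ∂P)) :
    f 0 = 0 ∧
    ∀ (n : ℕ) (t : Fin n → ℝ) (l : Fin n → ℂ),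
      (∑ j : Fin n, ∑ k : Fin n,
        (starRingEnd ℂ) (l j) * l k * (f (t k - t j) - f (-(t j)) - f (t k))).im = 0 ∧
      0 ≤ (∑ j : Fin n, ∑ k : Fin n,
        (starRingEnd ℂ) (l j) * l k * (f (t k - t j) - f (-(t j)) - f (t k))).re ∧
      (∑ j : Fin n, ∑ k : Fin n,
        (starRingEnd ℂ) (l j) * l k * (f (t k - t j) - f (-(t j)) - f (t k))) =
        (lam : ℂ) * (((a ^ 2 * ‖∑ j : Fin n, l j * (t j : ℂ)‖ ^ 2 : ℝ) : ℂ) +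
          (c : ℂ) * ((∫ p : ℝ, ‖∑ j : Fin n,
            l j * (Complex.exp (Complex.I * (p : ℂ) * ((t j : ℝ) : ℂ)) - 1)‖ ^ 2 ∂P : ℝ) : ℂ)) := by
  refine ⟨by simp [hf], fun n t l => ?_⟩
  have key : (∑ j : Fin n, ∑ k : Fin n,
        (starRingEnd ℂ) (l j) * l k * (f (t k - t j) - f (-(t j)) - f (t k))) =
        (lam : ℂ) * (((a ^ 2 * ‖∑ j : Fin n, l j * (t j : ℂ)‖ ^ 2 : ℝ) : ℂ) +
          (c : ℂ) * ((∫ p : ℝ, ‖∑ j : Fin n,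
            l j * (Complex.exp (Complex.I * (p : ℂ) * ((t j : ℝ) : ℂ)) - 1)‖ ^ 2 ∂P : ℝ) : ℂ)) := by
    have hi : ∀ j k : Fin n, Integrable (fun p : ℝ =>
        (starRingEnd ℂ) (Complex.exp (Complex.I * (p : ℂ) * (t j : ℂ)) - 1) *
          (Complex.exp (Complex.I * (p : ℂ) * (t k : ℂ)) - 1)) P := by
      intro j k
      simp_rw [← dF_pt]
      exact ((dF_int P _).sub (dF_int P _)).sub (dF_int P _)
    have hk : ∀ j k : Fin n, f (t k - t j) - f (-(t j)) - f (t k) =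
        (lam : ℂ) * ((a : ℂ) ^ 2 * ((starRingEnd ℂ) (t j : ℂ) * (t k : ℂ)) + (c : ℂ) * ∫ p : ℝ,
          (starRingEnd ℂ) (Complex.exp (Complex.I * (p : ℂ) * (t j : ℂ)) - 1) *
          (Complex.exp (Complex.I * (p : ℂ) * (t k : ℂ)) - 1) ∂P) := by
      intro j k
      simp_rw [← dF_pt]
      rw [integral_sub (f := fun p : ℝ => (Complex.exp (Complex.I * (p : ℂ) * ((t k - t j : ℝ) : ℂ)) - 1)
          - (Complex.exp (Complex.I * (p : ℂ) * ((-t j : ℝ) : ℂ)) - 1))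
          ((dF_int P _).sub (dF_int P _)) (dF_int P _),
        integral_sub (dF_int P _) (dF_int P _), hf, hf, hf, Complex.conj_ofReal]
      push_cast
      ring
    have h2 : ((∫ p : ℝ, ‖∑ j : Fin n,
            l j * (Complex.exp (Complex.I * (p : ℂ) * ((t j : ℝ) : ℂ)) - 1)‖ ^ 2 ∂P : ℝ) : ℂ) =
        ∑ j : Fin n, ∑ k : Fin n, (starRingEnd ℂ) (l j) * l k * ∫ p : ℝ,
          (starRingEnd ℂ) (Complex.exp (Complex.I * (p : ℂ) * (t j : ℂ)) - 1) *
          (Complex.exp (Complex.I * (p : ℂ) * (t k : ℂ)) - 1) ∂P := by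
      rw [← integral_complex_ofReal]
      simp_rw [← dF_sq]
      rw [integral_finsetSum _ fun j _ => integrable_finsetSum _ fun k _ => (hi j k).const_mul _]
      refine Finset.sum_congr rfl fun j _ => ?_
      rw [integral_finsetSum _ fun k _ => (hi j k).const_mul _]
      exact Finset.sum_congr rfl fun k _ => integral_const_mul _ _
    rw [h2, Complex.ofReal_mul, ← dF_sq]
    simp_rw [hk, Finset.mul_sum, ← Finset.sum_add_distrib, Finset.mul_sum]
    refine Finset.sum_congr rfl fun j _ => Finset.sum_congr rfl fun k _ => ?_
    push_cast
    ring
  have hr : 0 ≤ lam * (a ^ 2 * ‖∑ j : Fin n, l j * (t j : ℂ)‖ ^ 2 + c * ∫ p : ℝ, ‖∑ j : Fin n,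
            l j * (Complex.exp (Complex.I * (p : ℂ) * ((t j : ℝ) : ℂ)) - 1)‖ ^ 2 ∂P) := by
    have : 0 ≤ ∫ p : ℝ, ‖∑ j : Fin n,
            l j * (Complex.exp (Complex.I * (p : ℂ) * ((t j : ℝ) : ℂ)) - 1)‖ ^ 2 ∂P :=
      integral_nonneg fun p => by positivity
    positivity
  refine ⟨?_, ?_, key⟩
  · rw [key, ← Complex.ofReal_mul, ← Complex.ofReal_add, ← Complex.ofReal_mul, Complex.ofReal_im]
  · rw [key, ← Complex.ofReal_mul, ← Complex.ofReal_add, ← Complex.ofReal_mul, Complex.ofReal_re]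
    exact hr
end

section
/- Let a, b ∈ ℝ and let w : ℝ → ℝ be a measurable function with w ≥ 0 and ∫ p²·w(p) dp < ∞ (with respect to Lebesgue measure). Define f : ℝ → ℂ by the Kolmogorov formula f(t) = i·b·t − (a²/2)·t² + ∫ (exp(i·p·t) − 1 − i·t·p)·w(p) dp. Then the integral converges for every t, f(0) = 0, and f is conditionally positive semidefinite on the additive group ℝ: for every t₁,…,tₙ ∈ ℝ and λ₁,…,λₙ ∈ ℂ, the sum ∑_{j,k} conj(λⱼ)λₖ (f(tₖ − tⱼ) − f(−tⱼ) − f(tₖ)) is a nonnegative real number; indeed it equals a²·|∑_j λⱼ tⱼ|² + ∫ |∑_j λⱼ (exp(i·p·tⱼ) − 1)|²·w(p) dp. -/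
open Finset MeasureTheory

theorem kolm_norm_bound (x : ℝ) :
    ‖Complex.exp (Complex.I * (x : ℂ)) - 1 - Complex.I * (x : ℂ)‖ ≤ 3 * x ^ 2 := by
  have hn : ‖Complex.I * (x : ℂ)‖ = |x| := by simp
  by_cases hx : |x| ≤ 1
  · have h := Complex.norm_exp_sub_one_sub_id_le (x := Complex.I * (x : ℂ)) (by rw [hn]; exact hx)
    rw [hn, sq_abs] at h
    nlinarith [sq_nonneg x]
  · push Not at hx
    have h1 : ‖Complex.exp (Complex.I * (x : ℂ))‖ = 1 := by
      rw [mul_comm]; exact Complex.norm_exp_ofReal_mul_I x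
    have h2 : ‖Complex.exp (Complex.I * (x : ℂ)) - 1 - Complex.I * (x : ℂ)‖ ≤ 1 + 1 + |x| := by
      refine (norm_sub_le _ _).trans ?_
      rw [hn]
      have := norm_sub_le (Complex.exp (Complex.I * (x : ℂ))) 1
      rw [h1, norm_one] at this
      linarith
    nlinarith [sq_abs x]

theorem kolm_normsq {n : ℕ} (z : Fin n → ℂ) :
    ((‖∑ j, z j‖ ^ 2 : ℝ) : ℂ) = ∑ j, ∑ k, (starRingEnd ℂ) (z j) * z k := by
  rw [Complex.ofReal_pow, ← Complex.conj_mul', map_sum, Finset.sum_mul_sum]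

theorem kolm_integrable (w : ℝ → ℝ)
    (hw_meas : Measurable w) (hw_nonneg : ∀ p, 0 ≤ w p)
    (hw_var : Integrable (fun p : ℝ => p ^ 2 * w p)) (t : ℝ) :
    Integrable (fun p : ℝ =>
      (Complex.exp (Complex.I * (p : ℂ) * (t : ℂ)) - 1 -
        Complex.I * (t : ℂ) * (p : ℂ)) * ((w p : ℝ) : ℂ)) := by
  refine (hw_var.const_mul (3 * t ^ 2)).mono' ?_ ?_
  · apply Measurable.aestronglyMeasurable
    fun_prop
  · refine Filter.Eventually.of_forall fun p => ?_
    have h := kolm_norm_bound (p * t)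
    rw [norm_mul, Complex.norm_real, Real.norm_of_nonneg (hw_nonneg p)]
    have e : Complex.exp (Complex.I * (p : ℂ) * (t : ℂ)) - 1 - Complex.I * (t : ℂ) * (p : ℂ)
        = Complex.exp (Complex.I * ((p * t : ℝ) : ℂ)) - 1 - Complex.I * ((p * t : ℝ) : ℂ) := by
      push_cast; ring_nf
    rw [e]
    calc _ ≤ 3 * (p * t) ^ 2 * w p := mul_le_mul_of_nonneg_right h (hw_nonneg p)
      _ = _ := by ring

theorem kolm_pointwise (p s u : ℝ) (c : ℂ) :
    (Complex.exp (Complex.I * (p : ℂ) * ((u - s : ℝ) : ℂ)) - 1 -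
        Complex.I * ((u - s : ℝ) : ℂ) * (p : ℂ)) * c -
    (Complex.exp (Complex.I * (p : ℂ) * ((-s : ℝ) : ℂ)) - 1 -
        Complex.I * ((-s : ℝ) : ℂ) * (p : ℂ)) * c -
    (Complex.exp (Complex.I * (p : ℂ) * (u : ℂ)) - 1 -
        Complex.I * (u : ℂ) * (p : ℂ)) * c =
    (starRingEnd ℂ) (Complex.exp (Complex.I * (p : ℂ) * (s : ℂ)) - 1) *
      (Complex.exp (Complex.I * (p : ℂ) * (u : ℂ)) - 1) * c := by
  have h1 : (starRingEnd ℂ) (Complex.exp (Complex.I * (p : ℂ) * (s : ℂ)) - 1) =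
      Complex.exp (Complex.I * (p : ℂ) * ((-s : ℝ) : ℂ)) - 1 := by
    rw [map_sub, ← Complex.exp_conj, map_one]
    simp
  have h2 : Complex.exp (Complex.I * (p : ℂ) * ((u - s : ℝ) : ℂ)) =
      Complex.exp (Complex.I * (p : ℂ) * ((-s : ℝ) : ℂ)) *
      Complex.exp (Complex.I * (p : ℂ) * (u : ℂ)) := by
    rw [← Complex.exp_add]; congr 1; push_cast; ring
  rw [h1, h2]; push_cast; ring

/-- Kolmogorov's formula: if `w ≥ 0` is measurable with `∫ p² w(p) dp < ∞`,
then the exponent `f(t) = ibt − (a²/2)t² + ∫(e^{ipt} − 1 − itp) w(p) dp`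
is well defined (the integrand is integrable for every `t`), satisfies
`f(0) = 0`, and is conditionally positive semidefinite; indeed the kernel sum
equals `a²|∑ⱼλⱼtⱼ|² + ∫|∑ⱼλⱼ(e^{iptⱼ} − 1)|² w(p) dp`. -/
theorem kolmogorov_formula_conditionally_positive
    (a b : ℝ) (w : ℝ → ℝ)
    (hw_meas : Measurable w) (hw_nonneg : ∀ p, 0 ≤ w p)
    (hw_var : Integrable (fun p : ℝ => p ^ 2 * w p))
    (f : ℝ → ℂ)
    (hf : ∀ t : ℝ, f t =
      Complex.I * (b : ℂ) * (t : ℂ) - ((a : ℂ) ^ 2 / 2) * (t : ℂ) ^ 2 +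
        ∫ p : ℝ, (Complex.exp (Complex.I * (p : ℂ) * (t : ℂ)) - 1 -
          Complex.I * (t : ℂ) * (p : ℂ)) * ((w p : ℝ) : ℂ)) :
    (∀ t : ℝ, Integrable (fun p : ℝ =>
      (Complex.exp (Complex.I * (p : ℂ) * (t : ℂ)) - 1 -
        Complex.I * (t : ℂ) * (p : ℂ)) * ((w p : ℝ) : ℂ))) ∧
    f 0 = 0 ∧
    ∀ (n : ℕ) (t : Fin n → ℝ) (l : Fin n → ℂ),
      (∑ j : Fin n, ∑ k : Fin n,
        (starRingEnd ℂ) (l j) * l k * (f (t k - t j) - f (-(t j)) - f (t k))).im = 0 ∧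
      0 ≤ (∑ j : Fin n, ∑ k : Fin n,
        (starRingEnd ℂ) (l j) * l k * (f (t k - t j) - f (-(t j)) - f (t k))).re ∧
      (∑ j : Fin n, ∑ k : Fin n,
        (starRingEnd ℂ) (l j) * l k * (f (t k - t j) - f (-(t j)) - f (t k))) =
        ((a ^ 2 * ‖∑ j : Fin n, l j * (t j : ℂ)‖ ^ 2 : ℝ) : ℂ) +
          ((∫ p : ℝ, ‖∑ j : Fin n,
            l j * (Complex.exp (Complex.I * (p : ℂ) * ((t j : ℝ) : ℂ)) - 1)‖ ^ 2 * w p : ℝ) : ℂ) := by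
  have hI := kolm_integrable w hw_meas hw_nonneg hw_var
  refine ⟨hI, by rw [hf]; simp, ?_⟩
  intro n t l
  have hIjk : ∀ s u : ℝ, Integrable (fun p : ℝ =>
      (starRingEnd ℂ) (Complex.exp (Complex.I * (p : ℂ) * (s : ℂ)) - 1) *
      (Complex.exp (Complex.I * (p : ℂ) * (u : ℂ)) - 1) * ((w p : ℝ) : ℂ)) := by
    intro s u
    refine (((hI (u - s)).sub (hI (-s))).sub (hI u)).congr ?_
    exact Filter.Eventually.of_forall fun p => kolm_pointwise p s u _
  have hjk : ∀ s u : ℝ, f (u - s) - f (-s) - f u = (a : ℂ) ^ 2 * (s * u) +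
      ∫ p : ℝ, (starRingEnd ℂ) (Complex.exp (Complex.I * (p : ℂ) * (s : ℂ)) - 1) *
      (Complex.exp (Complex.I * (p : ℂ) * (u : ℂ)) - 1) * ((w p : ℝ) : ℂ) := by
    intro s u
    have h : ∫ p : ℝ, (starRingEnd ℂ) (Complex.exp (Complex.I * (p : ℂ) * (s : ℂ)) - 1) *
        (Complex.exp (Complex.I * (p : ℂ) * (u : ℂ)) - 1) * ((w p : ℝ) : ℂ) = _ :=
      (integral_congr_ae (Filter.Eventually.of_forall
        fun p => (kolm_pointwise p s u ((w p : ℝ) : ℂ)).symm))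
    rw [h, integral_sub (by exact (hI (u - s)).sub (hI (-s))) (hI u),
      integral_sub (hI (u - s)) (hI (-s)), hf, hf, hf]
    push_cast
    ring
  have key : (∑ j : Fin n, ∑ k : Fin n,
        (starRingEnd ℂ) (l j) * l k * (f (t k - t j) - f (-(t j)) - f (t k))) =
        ((a ^ 2 * ‖∑ j : Fin n, l j * (t j : ℂ)‖ ^ 2 : ℝ) : ℂ) +
          ((∫ p : ℝ, ‖∑ j : Fin n,
            l j * (Complex.exp (Complex.I * (p : ℂ) * ((t j : ℝ) : ℂ)) - 1)‖ ^ 2 * w p : ℝ) : ℂ) := by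
    rw [← integral_complex_ofReal]
    simp_rw [hjk, mul_add, Finset.sum_add_distrib]
    congr 1
    · rw [Complex.ofReal_mul, kolm_normsq, Finset.mul_sum]
      refine Finset.sum_congr rfl fun j _ => ?_
      rw [Finset.mul_sum]
      refine Finset.sum_congr rfl fun k _ => ?_
      rw [map_mul, Complex.conj_ofReal]
      push_cast; ring
    · simp_rw [Complex.ofReal_mul, kolm_normsq, Finset.sum_mul]
      have hc : ∀ j k : Fin n, ∀ p : ℝ,
          (starRingEnd ℂ) (l j * (Complex.exp (Complex.I * (p : ℂ) * ((t j : ℝ) : ℂ)) - 1)) *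
          (l k * (Complex.exp (Complex.I * (p : ℂ) * ((t k : ℝ) : ℂ)) - 1)) * ((w p : ℝ) : ℂ) =
          (starRingEnd ℂ) (l j) * l k *
          ((starRingEnd ℂ) (Complex.exp (Complex.I * (p : ℂ) * ((t j : ℝ) : ℂ)) - 1) *
          (Complex.exp (Complex.I * (p : ℂ) * ((t k : ℝ) : ℂ)) - 1) * ((w p : ℝ) : ℂ)) := by
        intro j k p
        rw [map_mul]; ring
      simp_rw [hc]
      rw [integral_finsetSum _ fun j _ => integrable_finsetSum _ fun k _ =>
        (hIjk (t j) (t k)).const_mul _]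
      refine Finset.sum_congr rfl fun j _ => ?_
      rw [integral_finsetSum _ fun k _ => (hIjk (t j) (t k)).const_mul _]
      refine Finset.sum_congr rfl fun k _ => ?_
      rw [integral_const_mul]
  rw [key, ← Complex.ofReal_add]
  refine ⟨Complex.ofReal_im _, ?_, rfl⟩
  rw [Complex.ofReal_re]
  exact add_nonneg (by positivity)
    (integral_nonneg fun p => mul_nonneg (by positivity) (hw_nonneg p))
end

section
/- Let a ≥ 0, b ∈ ℝ, and let ν be a nonnegative measure on ℝ with ν({0}) = 0 and ∫ min(p², 1) dν(p) < ∞. Define f : ℝ → ℂ by the Lévy formula f(t) = i·b·t − (a/2)·t² + ∫ ( exp(i·p·t) − 1 − i·p·t/(1 + p²) ) dν(p). Then the integral converges absolutely for every t, f(0) = 0, and f is conditionally positive semidefinite on the additive group ℝ: for every t₁,…,tₙ ∈ ℝ and λ₁,…,λₙ ∈ ℂ, the sum ∑_{j,k} conj(λⱼ)λₖ (f(tₖ − tⱼ) − f(−tⱼ) − f(tₖ)) is a nonnegative real number; indeed it equals a·|∑_j λⱼ tⱼ|² + ∫ |∑_j λⱼ (exp(i·p·tⱼ) − 1)|² dν(p).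 -/
open Finset MeasureTheory

open Complex in
lemma levy_bound (p t : ℝ) :
    ‖Complex.exp (Complex.I * (p : ℂ) * (t : ℂ)) - 1 -
        Complex.I * (p : ℂ) * (t : ℂ) / (1 + (p : ℂ) ^ 2)‖ ≤
      (3 * t ^ 2 + |t| + 2) * min (p ^ 2) 1 := by
  have hE : ‖Complex.exp (Complex.I * (p : ℂ) * (t : ℂ))‖ = 1 := by
    rw [show Complex.I * (p : ℂ) * (t : ℂ) = ((p * t : ℝ) : ℂ) * Complex.I by push_cast; ring]
    exact Complex.norm_exp_ofReal_mul_I _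
  have hx : ‖Complex.I * (p : ℂ) * (t : ℂ)‖ = |p| * |t| := by simp
  have hE1 : ‖Complex.exp (Complex.I * (p : ℂ) * (t : ℂ)) - 1‖ ≤ 2 := by
    refine (norm_sub_le _ _).trans ?_
    rw [hE, norm_one]; norm_num
  have hd : ‖(1 + (p : ℂ) ^ 2)‖ = 1 + p ^ 2 := by
    rw [show (1 + (p : ℂ) ^ 2) = ((1 + p ^ 2 : ℝ) : ℂ) by push_cast; ring, Complex.norm_real,
      Real.norm_eq_abs, abs_of_pos (by positivity)]
  have hd0 : (1 + (p : ℂ) ^ 2) ≠ 0 := by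
    rw [← norm_ne_zero_iff, hd]; positivity
  have hp0 := abs_nonneg p
  have ht0 := abs_nonneg t
  have hp2 := sq_abs p
  have ht2 := sq_abs t
  rcases le_total (p ^ 2) 1 with h | h
  · rw [min_eq_left h]
    have hp1 : |p| ≤ 1 := by nlinarith
    have e : Complex.exp (Complex.I * (p : ℂ) * (t : ℂ)) - 1 -
        Complex.I * (p : ℂ) * (t : ℂ) / (1 + (p : ℂ) ^ 2) =
        (Complex.exp (Complex.I * (p : ℂ) * (t : ℂ)) - 1 - Complex.I * (p : ℂ) * (t : ℂ)) +
        Complex.I * (p : ℂ) * (t : ℂ) * ((p : ℂ) ^ 2 / (1 + (p : ℂ) ^ 2)) := by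
      field_simp; ring
    rw [e]
    have h1 : ‖Complex.exp (Complex.I * (p : ℂ) * (t : ℂ)) - 1 - Complex.I * (p : ℂ) * (t : ℂ)‖
        ≤ 3 * (|p| * |t|) ^ 2 := by
      rcases le_total (|p| * |t|) 1 with h' | h'
      · have := Complex.norm_exp_sub_one_sub_id_le (hx.trans_le h')
        rw [hx] at this
        nlinarith [sq_nonneg (|p| * |t|)]
      · refine (norm_sub_le _ _).trans ?_
        rw [hx]
        nlinarith
    have h2 : ‖Complex.I * (p : ℂ) * (t : ℂ) * ((p : ℂ) ^ 2 / (1 + (p : ℂ) ^ 2))‖ ≤ |t| * p ^ 2 := by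
      rw [norm_mul, hx, norm_div, hd, norm_pow, Complex.norm_real, Real.norm_eq_abs, sq_abs]
      have : p ^ 2 / (1 + p ^ 2) ≤ p ^ 2 := div_le_self (sq_nonneg p) (by nlinarith)
      calc |p| * |t| * (p ^ 2 / (1 + p ^ 2)) ≤ 1 * |t| * p ^ 2 := by gcongr
        _ = |t| * p ^ 2 := by ring
    have h3 : 3 * (|p| * |t|) ^ 2 = 3 * t ^ 2 * p ^ 2 := by rw [mul_pow, hp2, ht2]; ring
    refine (norm_add_le _ _).trans ?_
    nlinarith [sq_nonneg p]
  · rw [min_eq_right h]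
    refine (norm_sub_le _ _).trans ?_
    have h2 : ‖Complex.I * (p : ℂ) * (t : ℂ) / (1 + (p : ℂ) ^ 2)‖ ≤ |t| := by
      rw [norm_div, hx, hd, div_le_iff₀ (by positivity)]
      nlinarith [mul_nonneg ht0 (show 0 ≤ 1 + p ^ 2 - |p| by nlinarith [sq_nonneg (|p| - 1)])]
    nlinarith [sq_nonneg t]

lemma levy_pointwise (p : ℝ) (n : ℕ) (t : Fin n → ℝ) (l : Fin n → ℂ) (g : ℝ → ℂ)
    (hg : ∀ t : ℝ, g t = Complex.exp (Complex.I * (p : ℂ) * (t : ℂ)) - 1 -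
        Complex.I * (p : ℂ) * (t : ℂ) / (1 + (p : ℂ) ^ 2)) :
    (∑ j : Fin n, ∑ k : Fin n,
        (starRingEnd ℂ) (l j) * l k * (g (t k - t j) - g (-(t j)) - g (t k))) =
    ((‖∑ j : Fin n,
      l j * (Complex.exp (Complex.I * (p : ℂ) * ((t j : ℝ) : ℂ)) - 1)‖ ^ 2 : ℝ) : ℂ) := by
  push_cast
  rw [← Complex.conj_mul', map_sum, Finset.sum_mul_sum]
  refine Finset.sum_congr rfl fun j _ => Finset.sum_congr rfl fun k _ => ?_
  have hc : (starRingEnd ℂ) (Complex.exp (Complex.I * (p : ℂ) * (t j : ℂ))) =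
      Complex.exp (-(Complex.I * (p : ℂ) * (t j : ℂ))) := by
    rw [← Complex.exp_conj]; simp
  rw [map_mul, map_sub, map_one, hc, hg, hg, hg]
  push_cast
  rw [show Complex.I * (p : ℂ) * ((t k : ℂ) - (t j : ℂ)) =
      -(Complex.I * (p : ℂ) * (t j : ℂ)) + Complex.I * (p : ℂ) * (t k : ℂ) by ring,
    Complex.exp_add, show Complex.I * (p : ℂ) * (-(t j : ℂ)) =
      -(Complex.I * (p : ℂ) * (t j : ℂ)) by ring]
  ring

/-- The Lévy formula: if `ν` is a nonnegative measure on `ℝ` with `ν({0}) = 0`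
and `∫ min(p², 1) dν(p) < ∞`, then the Lévy exponent
`f(t) = ibt − (a/2)t² + ∫(e^{ipt} − 1 − ipt/(1+p²)) dν(p)`
is well defined (the integrand is integrable for every `t`), satisfies
`f(0) = 0`, and is conditionally positive semidefinite; indeed the kernel sum
equals `a|∑ⱼλⱼtⱼ|² + ∫|∑ⱼλⱼ(e^{iptⱼ} − 1)|² dν(p)`. -/
theorem levy_formula_conditionally_positive
    (a : ℝ) (ha : 0 ≤ a) (b : ℝ)
    (ν : Measure ℝ) (hν0 : ν {0} = 0)
    (hνint : (∫⁻ p : ℝ, ENNReal.ofReal (min (p ^ 2) 1) ∂ν) < ⊤)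
    (f : ℝ → ℂ)
    (hf : ∀ t : ℝ, f t =
      Complex.I * (b : ℂ) * (t : ℂ) - ((a : ℂ) / 2) * (t : ℂ) ^ 2 +
        ∫ p : ℝ, (Complex.exp (Complex.I * (p : ℂ) * (t : ℂ)) - 1 -
          Complex.I * (p : ℂ) * (t : ℂ) / (1 + (p : ℂ) ^ 2)) ∂ν) :
    (∀ t : ℝ, Integrable (fun p : ℝ =>
      Complex.exp (Complex.I * (p : ℂ) * (t : ℂ)) - 1 -
        Complex.I * (p : ℂ) * (t : ℂ) / (1 + (p : ℂ) ^ 2)) ν) ∧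
    f 0 = 0 ∧
    ∀ (n : ℕ) (t : Fin n → ℝ) (l : Fin n → ℂ),
      (∑ j : Fin n, ∑ k : Fin n,
        (starRingEnd ℂ) (l j) * l k * (f (t k - t j) - f (-(t j)) - f (t k))).im = 0 ∧
      0 ≤ (∑ j : Fin n, ∑ k : Fin n,
        (starRingEnd ℂ) (l j) * l k * (f (t k - t j) - f (-(t j)) - f (t k))).re ∧
      (∑ j : Fin n, ∑ k : Fin n,
        (starRingEnd ℂ) (l j) * l k * (f (t k - t j) - f (-(t j)) - f (t k))) =
        ((a * ‖∑ j : Fin n, l j * (t j : ℂ)‖ ^ 2 : ℝ) : ℂ) +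
          ((∫ p : ℝ, ‖∑ j : Fin n,
            l j * (Complex.exp (Complex.I * (p : ℂ) * ((t j : ℝ) : ℂ)) - 1)‖ ^ 2 ∂ν : ℝ) : ℂ) := by
  have hI : ∀ t : ℝ, Integrable (fun p : ℝ =>
      Complex.exp (Complex.I * (p : ℂ) * (t : ℂ)) - 1 -
        Complex.I * (p : ℂ) * (t : ℂ) / (1 + (p : ℂ) ^ 2)) ν := by
    intro t
    have hm : Integrable (fun p : ℝ => min (p ^ 2) 1) ν := by
      refine ⟨by fun_prop, ?_⟩
      rw [hasFiniteIntegral_iff_ofReal (Filter.Eventually.of_forall fun p => by positivity)]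
      exact hνint
    refine (hm.const_mul (3 * t ^ 2 + |t| + 2)).mono' ?_
      (Filter.Eventually.of_forall fun p => levy_bound p t)
    exact Measurable.aestronglyMeasurable (by fun_prop)
  refine ⟨hI, by rw [hf]; simp, ?_⟩
  intro n t l
  have key : (∑ j : Fin n, ∑ k : Fin n,
        (starRingEnd ℂ) (l j) * l k * (f (t k - t j) - f (-(t j)) - f (t k))) =
        ((a * ‖∑ j : Fin n, l j * (t j : ℂ)‖ ^ 2 : ℝ) : ℂ) +
          ((∫ p : ℝ, ‖∑ j : Fin n,
            l j * (Complex.exp (Complex.I * (p : ℂ) * ((t j : ℝ) : ℂ)) - 1)‖ ^ 2 ∂ν : ℝ) : ℂ) := by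
    obtain ⟨g, hg⟩ : ∃ g : ℝ → ℝ → ℂ, ∀ t p : ℝ, g t p =
        Complex.exp (Complex.I * (p : ℂ) * (t : ℂ)) - 1 -
        Complex.I * (p : ℂ) * (t : ℂ) / (1 + (p : ℂ) ^ 2) := ⟨_, fun _ _ => rfl⟩
    have hgI : ∀ t, Integrable (g t) ν := fun t => by
      rw [show g t = _ from funext (hg t)]; exact hI t
    have hf2 : ∀ t : ℝ, f t = Complex.I * (b : ℂ) * (t : ℂ) - ((a : ℂ) / 2) * (t : ℂ) ^ 2 +
        ∫ p : ℝ, g t p ∂ν := fun t => by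
      rw [hf]; simp only [hg]
    rw [← integral_complex_ofReal]
    simp only [← fun p => levy_pointwise p n t l (fun t => g t p) (fun t => hg t p)]
    have hterm : ∀ j k : Fin n, Integrable (fun p => (starRingEnd ℂ) (l j) * l k *
        (g (t k - t j) p - g (-(t j)) p - g (t k) p)) ν := fun j k =>
      (((hgI _).sub (hgI _)).sub (hgI _)).const_mul _
    rw [integral_finsetSum _ fun j _ => integrable_finsetSum _ fun k _ => hterm j k]
    have h1 : ∀ j : Fin n, ∫ p, ∑ k : Fin n, (starRingEnd ℂ) (l j) * l k *
        (g (t k - t j) p - g (-(t j)) p - g (t k) p) ∂ν =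
        ∑ k : Fin n, (starRingEnd ℂ) (l j) * l k *
        (∫ p, g (t k - t j) p ∂ν - ∫ p, g (-(t j)) p ∂ν - ∫ p, g (t k) p ∂ν) := fun j => by
      rw [integral_finsetSum _ fun k _ => hterm j k]
      refine Finset.sum_congr rfl fun k _ => ?_
      rw [integral_const_mul, integral_sub (f := fun p => g (t k - t j) p - g (-(t j)) p)
          ((hgI _).sub (hgI _)) (hgI _),
        integral_sub (hgI _) (hgI _)]
    simp only [h1]
    push_cast
    rw [← Complex.conj_mul', map_sum, Finset.sum_mul_sum, Finset.mul_sum, ← Finset.sum_add_distrib]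
    refine Finset.sum_congr rfl fun j _ => ?_
    rw [Finset.mul_sum, ← Finset.sum_add_distrib]
    refine Finset.sum_congr rfl fun k _ => ?_
    rw [map_mul, Complex.conj_ofReal, hf2, hf2, hf2]
    push_cast
    ring
  refine ⟨?_, ?_, key⟩
  · rw [key, ← Complex.ofReal_add, Complex.ofReal_im]
  · rw [key, ← Complex.ofReal_add, Complex.ofReal_re]
    exact add_nonneg (by positivity) (integral_nonneg fun p => by positivity)
end

section
/- Let a ≥ 0, b ∈ ℝ, and let ν be a nonnegative measure on ℝ with ν({0}) = 0 and ∫ min(p², 1) dν(p) < ∞, and let f : ℝ → ℂ be the Lévy exponent f(t) = i·b·t − (a/2)·t² + ∫ ( exp(i·p·t) − 1 − i·p·t/(1 + p²) ) dν(p). Then for every real c > 0 the function t ↦ exp(c·f(t)) is positive definite on ℝ: for all t₁,…,tₙ ∈ ℝ and λ₁,…,λₙ ∈ ℂ, the sum ∑_{j,k} conj(λⱼ)λₖ exp(c·f(tₖ − tⱼ)) is a nonnegative real number. In particular F = exp∘f admits a positive definite n-th root exp(f/n) for every n, i.e., F is the characteristic function of an infinitely divisible law. -/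
open Finset MeasureTheory

section LevyHelpers
open scoped ComplexOrder

lemma levy_psd_iff {n : ℕ} (K : Matrix (Fin n) (Fin n) ℂ) :
    K.PosSemidef ↔ K.IsHermitian ∧ ∀ l : Fin n → ℂ,
      0 ≤ ∑ j, ∑ k, (starRingEnd ℂ) (l j) * l k * K j k := by
  rw [Matrix.posSemidef_iff_dotProduct_mulVec]
  refine and_congr_right fun _ => forall_congr' fun l => ?_
  have : star l ⬝ᵥ (K.mulVec l) = ∑ j, ∑ k, (starRingEnd ℂ) (l j) * l k * K j k := by
    simp only [dotProduct, Matrix.mulVec, Finset.mul_sum, Pi.star_apply]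
    refine Finset.sum_congr rfl fun j _ => Finset.sum_congr rfl fun k _ => ?_
    rw [starRingEnd_apply]; ring
  rw [this]

lemma levy_pow_psd {n : ℕ} {K : Matrix (Fin n) (Fin n) ℂ} (hK : K.PosSemidef) (m : ℕ) :
    (Matrix.of fun j k => K j k ^ m).PosSemidef := by
  induction m with
  | zero =>
    rw [levy_psd_iff]
    refine ⟨by ext i j; simp, fun l => ?_⟩
    have : ∑ j, ∑ k, (starRingEnd ℂ) (l j) * l k * (Matrix.of fun j k => K j k ^ 0) j k
        = star (∑ j, l j) * (∑ k, l k) := by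
      simp [Finset.sum_mul_sum]
    rw [this]
    exact star_mul_self_nonneg _
  | succ m ih =>
    have h := ih.hadamard hK
    have e : (Matrix.of fun j k => K j k ^ (m + 1)) =
        (Matrix.of fun j k => K j k ^ m).hadamard K := by
      ext j k; simp [pow_succ]
    rw [e]
    exact h

lemma levy_exp_psd {n : ℕ} {K : Matrix (Fin n) (Fin n) ℂ} (hK : K.PosSemidef) (l : Fin n → ℂ) :
    0 ≤ ∑ j, ∑ k, (starRingEnd ℂ) (l j) * l k * Complex.exp (K j k) := by
  have hs : HasSum (fun m : ℕ => ∑ j, ∑ k, (starRingEnd ℂ) (l j) * l k *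
      (((m.factorial : ℂ)⁻¹) * K j k ^ m))
      (∑ j, ∑ k, (starRingEnd ℂ) (l j) * l k * Complex.exp (K j k)) := by
    refine hasSum_sum fun j _ => hasSum_sum fun k _ => HasSum.mul_left _ ?_
    have := NormedSpace.exp_series_hasSum_exp' (𝕂 := ℂ) (K j k)
    rw [← Complex.exp_eq_exp_ℂ] at this
    simpa using this
  refine hs.nonneg fun m => ?_
  have h := ((levy_psd_iff _).1 (levy_pow_psd hK m)).2 l
  have e : ∑ j, ∑ k, (starRingEnd ℂ) (l j) * l k * (((m.factorial : ℂ)⁻¹) * K j k ^ m)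
      = ((m.factorial : ℂ)⁻¹) * ∑ j, ∑ k, (starRingEnd ℂ) (l j) * l k *
        (Matrix.of fun j k => K j k ^ m) j k := by
    simp only [Finset.mul_sum, Matrix.of_apply]
    refine Finset.sum_congr rfl fun j _ => Finset.sum_congr rfl fun k _ => ?_
    ring
  rw [e]
  refine mul_nonneg ?_ h
  have : (0:ℝ) ≤ ((m.factorial : ℝ)⁻¹) := by positivity
  rw [← Complex.ofReal_natCast, ← Complex.ofReal_inv]
  exact Complex.zero_le_real.2 this

lemma levy_exp_bound (x : ℝ) :
    ‖Complex.exp (Complex.I * x) - 1 - Complex.I * x‖ ≤ 2 * x ^ 2 := by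
  have hn : ‖Complex.I * (x:ℂ)‖ = |x| := by simp
  by_cases h : |x| ≤ 1
  · have := Complex.norm_exp_sub_one_sub_id_le (x := Complex.I * x) (by rw [hn]; exact h)
    rw [hn, sq_abs] at this
    nlinarith [sq_nonneg x]
  · have h1 := Real.norm_exp_I_mul_ofReal_sub_one_le (x := x)
    rw [Real.norm_eq_abs] at h1
    have h2 := norm_sub_le (Complex.exp (Complex.I * x) - 1) (Complex.I * x)
    rw [hn] at h2
    rw [← sq_abs x]
    nlinarith

/-- The Lévy integrand. -/
noncomputable def levyG (t p : ℝ) : ℂ :=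
  Complex.exp (Complex.I * (p : ℂ) * (t : ℂ)) - 1 -
          Complex.I * (p : ℂ) * (t : ℂ) / (1 + (p : ℂ) ^ 2)

lemma levy_den (p : ℝ) : (1 + (p : ℂ) ^ 2) ≠ 0 := by
  have : (1 + p ^ 2 : ℝ) ≠ 0 := by positivity
  exact_mod_cast this

lemma levyG_bound (t p : ℝ) : ‖levyG t p‖ ≤ (2 + 2 * t ^ 2 + |t|) * min (p ^ 2) 1 := by
  have hpos : (0:ℝ) < 1 + p ^ 2 := by positivity
  have hnd : ‖(1 + (p : ℂ) ^ 2)‖ = 1 + p ^ 2 := by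
    have : (1 + (p : ℂ) ^ 2) = ((1 + p ^ 2 : ℝ) : ℂ) := by push_cast; ring
    rw [this, Complex.norm_real, Real.norm_eq_abs, abs_of_pos hpos]
  have hx : Complex.I * (p : ℂ) * (t : ℂ) = Complex.I * ((p * t : ℝ) : ℂ) := by push_cast; ring
  by_cases h : p ^ 2 ≤ 1
  · rw [min_eq_left h]
    have e : levyG t p = (Complex.exp (Complex.I * ((p * t : ℝ) : ℂ)) - 1
        - Complex.I * ((p * t : ℝ) : ℂ))
        + Complex.I * (p : ℂ) * (t : ℂ) * (p : ℂ) ^ 2 / (1 + (p : ℂ) ^ 2) := by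
      rw [levyG, ← hx]
      field_simp [levy_den p]
      ring
    have h1 := levy_exp_bound (p * t)
    have h2 : ‖Complex.I * (p : ℂ) * (t : ℂ) * (p : ℂ) ^ 2 / (1 + (p : ℂ) ^ 2)‖ ≤ |t| * p ^ 2 := by
      rw [norm_div, hnd, div_le_iff₀ hpos]
      simp only [norm_mul, Complex.norm_I, Complex.norm_real, Real.norm_eq_abs, norm_pow, sq_abs,
        one_mul]
      have hp1 : |p| ≤ 1 := (sq_le_one_iff_abs_le_one p).1 h
      have : |p| ≤ 1 + p ^ 2 := by nlinarith [sq_nonneg p]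
      calc |p| * |t| * p ^ 2 ≤ (1 + p ^ 2) * |t| * p ^ 2 := by gcongr
        _ = _ := by ring
    rw [e]
    refine (norm_add_le _ _).trans ?_
    nlinarith [sq_nonneg p]
  · push Not at h
    rw [min_eq_right h.le]
    have h1 : ‖Complex.exp (Complex.I * (p : ℂ) * (t : ℂ)) - 1‖ ≤ 2 := by
      refine (norm_sub_le _ _).trans ?_
      rw [hx, Complex.norm_exp_I_mul_ofReal]; norm_num
    have h2 : ‖Complex.I * (p : ℂ) * (t : ℂ) / (1 + (p : ℂ) ^ 2)‖ ≤ |t| := by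
      rw [norm_div, hnd, div_le_iff₀ hpos]
      simp only [norm_mul, Complex.norm_I, Complex.norm_real, Real.norm_eq_abs, one_mul]
      have : |p| ≤ 1 + p ^ 2 := by nlinarith [sq_nonneg (|p| - 1), sq_abs p]
      calc |p| * |t| ≤ (1 + p ^ 2) * |t| := by gcongr
        _ = _ := by ring
    refine (norm_sub_le _ _).trans ?_
    nlinarith [sq_nonneg t]

lemma levyG_integrable (ν : Measure ℝ)
    (hνint : (∫⁻ p : ℝ, ENNReal.ofReal (min (p ^ 2) 1) ∂ν) < ⊤) (t : ℝ) :
    Integrable (levyG t) ν := by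
  have hmin : Integrable (fun p : ℝ => min (p ^ 2) 1) ν := by
    refine ⟨by fun_prop, ?_⟩
    rw [hasFiniteIntegral_iff_ofReal (Filter.Eventually.of_forall fun p => by positivity)]
    exact hνint
  refine (hmin.const_mul (2 + 2 * t ^ 2 + |t|)).mono' ?_
    (Filter.Eventually.of_forall fun p => levyG_bound t p)
  have : Measurable (levyG t) := by unfold levyG; fun_prop
  exact this.aestronglyMeasurable

lemma levyG_conj (t p : ℝ) : levyG (-t) p = (starRingEnd ℂ) (levyG t p) := by
  simp [levyG, ← Complex.exp_conj]

lemma levyG_kernel (s t p : ℝ) : levyG (t - s) p - levyG t p - levyG (-s) p =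
    (starRingEnd ℂ) (Complex.exp (Complex.I * p * s) - 1) * (Complex.exp (Complex.I * p * t) - 1) := by
  have h1 : Complex.exp (Complex.I * p * ((t - s : ℝ) : ℂ)) =
      Complex.exp (-(Complex.I * p * s)) * Complex.exp (Complex.I * p * t) := by
    rw [← Complex.exp_add]; congr 1; push_cast; ring
  simp only [levyG]
  rw [h1]
  simp only [map_sub, map_one, ← Complex.exp_conj, map_mul, Complex.conj_I,
    Complex.conj_ofReal, Complex.ofReal_sub, Complex.ofReal_neg, neg_mul, mul_neg]
  generalize Complex.exp (-(Complex.I * p * s)) = A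
  generalize Complex.exp (Complex.I * p * t) = B
  ring

lemma levy_main (a : ℝ) (ha : 0 ≤ a) (b : ℝ) (ν : Measure ℝ)
    (hνint : (∫⁻ p : ℝ, ENNReal.ofReal (min (p ^ 2) 1) ∂ν) < ⊤)
    (f : ℝ → ℂ)
    (hf : ∀ t : ℝ, f t =
      Complex.I * (b : ℂ) * (t : ℂ) - ((a : ℂ) / 2) * (t : ℂ) ^ 2 + ∫ p : ℝ, levyG t p ∂ν)
    (c : ℝ) (hc : 0 < c) (n : ℕ) (t : Fin n → ℝ) (l : Fin n → ℂ) :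
    0 ≤ ∑ j : Fin n, ∑ k : Fin n,
        (starRingEnd ℂ) (l j) * l k * Complex.exp ((c : ℂ) * f (t k - t j)) := by
  have hint := levyG_integrable ν hνint
  have hconj : ∀ s, f (-s) = (starRingEnd ℂ) (f s) := by
    intro s
    rw [hf, hf]
    simp only [levyG_conj, integral_conj]
    simp only [map_add, map_sub, map_mul, map_div₀, map_pow, Complex.conj_ofReal, Complex.conj_I,
      Complex.ofReal_neg, map_ofNat]
    ring
  let K : Matrix (Fin n) (Fin n) ℂ :=
    Matrix.of fun j k => (c : ℂ) * (f (t k - t j) - f (t k) - f (- t j))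
  have hK : K.PosSemidef := by
    rw [levy_psd_iff]
    constructor
    · ext i j
      simp only [Matrix.conjTranspose_apply, K, Matrix.of_apply, ← starRingEnd_apply, map_mul,
        map_sub, Complex.conj_ofReal, ← hconj, neg_neg, neg_sub]
      ring
    · intro l
      have hKe : ∀ j k, K j k = (c : ℂ) * (a * (t j * t k) +
          ∫ p, (levyG (t k - t j) p - levyG (t k) p - levyG (-t j) p) ∂ν) := by
        intro j k
        have h1 : ∫ p, (levyG (t k - t j) p - levyG (t k) p - levyG (-t j) p) ∂ν
            = ∫ p, (levyG (t k - t j) p - levyG (t k) p) ∂ν - ∫ p, levyG (-t j) p ∂ν :=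
          integral_sub ((hint _).sub (hint _)) (hint _)
        rw [h1, integral_sub (hint _) (hint _)]
        simp only [K, Matrix.of_apply, hf]
        push_cast
        ring
      have hki : ∀ j k, Integrable (fun p => levyG (t k - t j) p - levyG (t k) p
          - levyG (-t j) p) ν := fun j k => ((hint _).sub (hint _)).sub (hint _)
      have hI : ∫ p, (((‖∑ k, l k * (Complex.exp (Complex.I * p * t k) - 1)‖ ^ 2 : ℝ)) : ℂ) ∂ν
          = ∑ j, ∑ k, (starRingEnd ℂ) (l j) * l k *
            ∫ p, (levyG (t k - t j) p - levyG (t k) p - levyG (-t j) p) ∂ν := by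
        simp_rw [← integral_const_mul]
        have h2 : ∀ j, ∑ k, ∫ p, (starRingEnd ℂ) (l j) * l k *
            (levyG (t k - t j) p - levyG (t k) p - levyG (-t j) p) ∂ν
            = ∫ p, ∑ k, (starRingEnd ℂ) (l j) * l k *
            (levyG (t k - t j) p - levyG (t k) p - levyG (-t j) p) ∂ν := fun j =>
          (integral_finsetSum _ fun k _ => (hki j k).const_mul _).symm
        simp_rw [h2]
        rw [← integral_finsetSum]
        swap
        · exact fun j _ => integrable_finsetSum _ fun k _ => (hki j k).const_mul _
        refine integral_congr_ae (Filter.Eventually.of_forall fun p => ?_)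
        simp only [levyG_kernel]
        rw [Complex.ofReal_pow, ← Complex.conj_mul', map_sum, Finset.sum_mul_sum]
        refine Finset.sum_congr rfl fun j _ => Finset.sum_congr rfl fun k _ => ?_
        rw [map_mul]
        ring
      have e : ∑ j, ∑ k, (starRingEnd ℂ) (l j) * l k * K j k
          = (c : ℂ) * (a * ((starRingEnd ℂ) (∑ j, l j * t j) * (∑ k, l k * t k)) +
            ∫ p, (((‖∑ k, l k * (Complex.exp (Complex.I * p * t k) - 1)‖ ^ 2 : ℝ)) : ℂ) ∂ν) := by
        rw [hI, map_sum, Finset.sum_mul_sum]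
        simp only [hKe, map_mul, Complex.conj_ofReal, Finset.mul_sum,
          ← Finset.sum_add_distrib]
        refine Finset.sum_congr rfl fun j _ => Finset.sum_congr rfl fun k _ => ?_
        ring
      rw [e]
      have hc' : (0:ℂ) ≤ c := by exact_mod_cast hc.le
      have ha' : (0:ℂ) ≤ a := by exact_mod_cast ha
      refine mul_nonneg hc' (add_nonneg (mul_nonneg ha' (star_mul_self_nonneg _)) ?_)
      rw [integral_complex_ofReal]
      have : 0 ≤ ∫ p, ‖∑ k, l k * (Complex.exp (Complex.I * p * t k) - 1)‖ ^ 2 ∂ν :=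
        integral_nonneg fun p => by positivity
      exact_mod_cast this
  have h := levy_exp_psd hK (fun k => l k * Complex.exp (c * f (t k)))
  refine h.trans_eq (Finset.sum_congr rfl fun j _ => Finset.sum_congr rfl fun k _ => ?_)
  have e : (c : ℂ) * f (t k - t j) = c * (starRingEnd ℂ) (f (t j)) + c * f (t k) + K j k := by
    simp only [K, Matrix.of_apply, hconj]
    ring
  rw [e, Complex.exp_add, Complex.exp_add]
  simp only [map_mul, ← Complex.exp_conj, Complex.conj_ofReal]
  ring

end LevyHelpers


/-- The Lévy(–Khintchine) exponent generates an infinitely divisible law: for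
every `c > 0` the function `t ↦ exp(c·f(t))` is positive definite on `ℝ`; in
particular `F = exp ∘ f` has a positive definite `n`-th root `exp(f/n)` for
every `n ≥ 1`. -/
theorem levy_exponent_infinitely_divisible
    (a : ℝ) (ha : 0 ≤ a) (b : ℝ)
    (ν : Measure ℝ) (hν0 : ν {0} = 0)
    (hνint : (∫⁻ p : ℝ, ENNReal.ofReal (min (p ^ 2) 1) ∂ν) < ⊤)
    (f : ℝ → ℂ)
    (hf : ∀ t : ℝ, f t =
      Complex.I * (b : ℂ) * (t : ℂ) - ((a : ℂ) / 2) * (t : ℂ) ^ 2 +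
        ∫ p : ℝ, (Complex.exp (Complex.I * (p : ℂ) * (t : ℂ)) - 1 -
          Complex.I * (p : ℂ) * (t : ℂ) / (1 + (p : ℂ) ^ 2)) ∂ν) :
    (∀ c : ℝ, 0 < c → ∀ (n : ℕ) (t : Fin n → ℝ) (l : Fin n → ℂ),
      (∑ j : Fin n, ∑ k : Fin n,
        (starRingEnd ℂ) (l j) * l k * Complex.exp ((c : ℂ) * f (t k - t j))).im = 0 ∧
      0 ≤ (∑ j : Fin n, ∑ k : Fin n,
        (starRingEnd ℂ) (l j) * l k * Complex.exp ((c : ℂ) * f (t k - t j))).re) ∧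
    (∀ m : ℕ, 0 < m → ∀ (n : ℕ) (t : Fin n → ℝ) (l : Fin n → ℂ),
      (∑ j : Fin n, ∑ k : Fin n,
        (starRingEnd ℂ) (l j) * l k * Complex.exp (f (t k - t j) / (m : ℂ))).im = 0 ∧
      0 ≤ (∑ j : Fin n, ∑ k : Fin n,
        (starRingEnd ℂ) (l j) * l k * Complex.exp (f (t k - t j) / (m : ℂ))).re) := by

  have hmain := levy_main a ha b ν hνint f hf
  have key : ∀ c : ℝ, 0 < c → ∀ (n : ℕ) (t : Fin n → ℝ) (l : Fin n → ℂ),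
      (∑ j : Fin n, ∑ k : Fin n,
        (starRingEnd ℂ) (l j) * l k * Complex.exp ((c : ℂ) * f (t k - t j))).im = 0 ∧
      0 ≤ (∑ j : Fin n, ∑ k : Fin n,
        (starRingEnd ℂ) (l j) * l k * Complex.exp ((c : ℂ) * f (t k - t j))).re := by
    intro c hc n t l
    have h := Complex.le_def.1 (hmain c hc n t l)
    exact ⟨h.2.symm, h.1⟩
  refine ⟨key, fun m hm n t l => ?_⟩
  have h := key ((m : ℝ)⁻¹) (by positivity) n t l
  have e : ∀ z : ℂ, (((m : ℝ)⁻¹ : ℝ) : ℂ) * z = z / (m : ℂ) := by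
    intro z; push_cast; rw [div_eq_inv_mul]
  simpa only [e] using h
end

section
/- Let μ be a probability measure on ℝ (with the Borel σ-algebra). Then the linear span (over ℂ) of the family of functions {x ↦ exp(i·s·x) : s ∈ ℝ} is dense in the complex Hilbert space L²(ℝ, μ). (Equivalently: the constant function 1 is a cyclic vector for the one-parameter unitary group U(s) of multiplication by exp(i·s·x) on L²(ℝ, μ).) -/
open MeasureTheory

lemma real_aux (μ : Measure ℝ) [IsProbabilityMeasure μ] (h : ℝ → ℝ) (hi : Integrable h μ)
    (h0 : ∀ s : ℝ, ∫ x, Complex.exp (s * x * Complex.I) * (h x : ℂ) ∂μ = 0) : h =ᵐ[μ] 0 := by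
  have hm := hi.aestronglyMeasurable.aemeasurable
  have f1 : IsFiniteMeasure (μ.withDensity fun x => ENNReal.ofReal (h x)) :=
    isFiniteMeasure_withDensity_ofReal hi.2
  have f2 : IsFiniteMeasure (μ.withDensity fun x => ENNReal.ofReal (-h x)) :=
    isFiniteMeasure_withDensity_ofReal hi.neg.2
  have key : ∀ (u : ℝ → ℝ), Integrable u μ → ∀ s : ℝ, 
      Integrable (fun x : ℝ => Complex.exp (s * x * Complex.I) * (u x : ℂ)) μ := by
    intro u hu s
    refine hu.ofReal.bdd_mul (c := 1) (by fun_prop) ?_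
    filter_upwards with x
    rw [← Complex.ofReal_mul, Complex.norm_exp_ofReal_mul_I]
  have e : (μ.withDensity fun x => ENNReal.ofReal (h x))
      = (μ.withDensity fun x => ENNReal.ofReal (-h x)) := by
    apply Measure.ext_of_charFun
    ext s
    rw [charFun_apply_real, charFun_apply_real,
      integral_withDensity_eq_integral_toReal_smul₀ (by fun_prop) (by simp),
      integral_withDensity_eq_integral_toReal_smul₀ (by fun_prop) (by simp), ← sub_eq_zero]
    have k1 := key _ hi.pos_part s
    have k2 := key _ hi.neg_part s
    simp only [ENNReal.toReal_ofReal', Complex.real_smul]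
    rw [← h0 s, ← integral_sub]
    · congr 1
      ext x
      have : (h x : ℂ) = ((max (h x) 0 - max (-h x) 0 : ℝ) : ℂ) := by
        congr 1
        rcases le_total (h x) 0 with hh | hh <;> simp [hh]
      rw [this]
      push_cast
      ring
    · simpa only [mul_comm] using k1
    · simpa only [mul_comm] using k2
  have e2 := (withDensity_eq_iff (by fun_prop) (by fun_prop) hi.lintegral_lt_top.ne).1 e
  filter_upwards [e2] with x hx
  have := congrArg ENNReal.toReal hx
  simp only [ENNReal.toReal_ofReal'] at this
  rcases le_total (h x) 0 with hh | hh <;> simp [hh] at this <;> simp [this]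

/-- For any probability measure `μ` on `ℝ`, the linear span of the exponentials
`x ↦ exp(isx)`, `s ∈ ℝ`, is dense in `L²(ℝ, μ)`: the constant function `1` is a
cyclic vector for the one-parameter unitary group of multiplication by
`exp(isx)`. -/
theorem exponentials_dense_in_L2
    (μ : Measure ℝ) [IsProbabilityMeasure μ] :
    Dense (↑(Submodule.span ℂ
      {f : Lp ℂ 2 μ | ∃ s : ℝ,
        f =ᵐ[μ] fun x : ℝ => Complex.exp (Complex.I * (s : ℂ) * (x : ℂ))}) :
      Set (Lp ℂ 2 μ)) := by
  rw [Submodule.dense_iff_topologicalClosure_eq_top, Submodule.topologicalClosure_eq_top_iff,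
    Submodule.eq_bot_iff]
  intro g hg
  have gi : Integrable g μ := (Lp.memLp g).integrable (by norm_num)
  have bd : ∀ s x : ℝ, ‖Complex.exp (s * x * Complex.I)‖ ≤ 1 := fun s x => by
    rw [← Complex.ofReal_mul, Complex.norm_exp_ofReal_mul_I]
  have i1 : ∀ s : ℝ, Integrable (fun x : ℝ => Complex.exp (s * x * Complex.I) * g x) μ := fun s =>
    gi.bdd_mul (c := 1) (by fun_prop) (.of_forall (bd s))
  have i2 : ∀ s : ℝ, Integrable
      (fun x : ℝ => Complex.exp (s * x * Complex.I) * (starRingEnd ℂ) (g x)) μ := fun s =>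
    (Complex.conjCLE.toContinuousLinearMap.integrable_comp gi).bdd_mul
      (c := 1) (by fun_prop) (.of_forall (bd s))
  have z1 : ∀ s : ℝ, ∫ x, Complex.exp (s * x * Complex.I) * g x ∂μ = 0 := by
    intro s
    have hmem : MemLp (fun x : ℝ => Complex.exp (Complex.I * ((-s : ℝ) : ℂ) * (x : ℂ))) 2 μ := by
      refine MemLp.of_bound (by fun_prop) 1 (.of_forall fun x => ?_)
      have := bd (-s) x
      rwa [mul_comm Complex.I, mul_right_comm]
    have := (Submodule.mem_orthogonal _ _).1 hg (hmem.toLp _)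
      (Submodule.subset_span ⟨-s, hmem.coeFn_toLp⟩)
    rw [L2.inner_def] at this
    rw [← this]
    apply integral_congr_ae
    filter_upwards [hmem.coeFn_toLp] with x hx
    rw [hx, RCLike.inner_apply, ← Complex.exp_conj, mul_comm]
    congr 2
    simp
    ring
  have z2 : ∀ s : ℝ, ∫ x, Complex.exp (s * x * Complex.I) * (starRingEnd ℂ) (g x) ∂μ = 0 := by
    intro s
    have := congrArg (starRingEnd ℂ) (z1 (-s))
    rw [← integral_conj, map_zero] at this
    rw [← this]
    congr 1
    ext x
    rw [map_mul, ← Complex.exp_conj]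
    simp
  have r := real_aux μ (fun x => (g x).re) gi.re (fun s => by
    have : ∫ x, (Complex.exp (s * x * Complex.I) * g x
      + Complex.exp (s * x * Complex.I) * (starRingEnd ℂ) (g x)) / 2 ∂μ = 0 := by
      rw [integral_div, integral_add (i1 s) (i2 s), z1, z2]; simp
    rw [← this]
    congr 1
    ext x
    rw [Complex.re_eq_add_conj]; ring)
  have m := real_aux μ (fun x => (g x).im) gi.im (fun s => by
    have : ∫ x, (Complex.exp (s * x * Complex.I) * g x
      - Complex.exp (s * x * Complex.I) * (starRingEnd ℂ) (g x)) / (2 * Complex.I) ∂μ = 0 := by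
      rw [integral_div, integral_sub (i1 s) (i2 s), z1, z2]; simp
    rw [← this]
    congr 1
    ext x
    rw [Complex.im_eq_sub_conj]; ring)
  rw [Lp.eq_zero_iff_ae_eq_zero]
  filter_upwards [r, m] with x hr hm
  exact Complex.ext hr hm
end
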